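/- Let a : ℝ^d → M_d(ℂ) be a smooth symbol of class S^r (‖∂^α a(ξ)‖ ≤ C_α (1+|ξ|²)^{(r−|α|)/2} for all multi-indices α) such that a(ξ) is Hermitian positive definite for every ξ and elliptic: ‖a(ξ)⁻¹‖ ≤ C(1+|ξ|²)^{−r/2}. Let b(ξ) denote the unique Hermitian positive definite square root of a(ξ). Then b is a smooth symbol of class S^{r/2} and is elliptic of order r/2: for every multi-index α, ‖∂^α b(ξ)‖ ≲ (1+|ξ|²)^{(r/2−|α|)/2}, and ‖b(ξ)⁻¹‖ ≲ (1+|ξ|²)^{−r/4}. -/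

import Mathlib

open Matrix
open scoped ComplexOrder

attribute [local instance] Matrix.frobeniusSeminormedAddCommGroup
  Matrix.frobeniusNormedAddCommGroup Matrix.frobeniusNormedSpace

section Symbol

variable {E F G H : Type*} [NormedAddCommGroup E] [NormedSpace ℝ E]
  [NormedAddCommGroup F] [NormedSpace ℝ F] [NormedAddCommGroup G] [NormedSpace ℝ G]
  [NormedAddCommGroup H] [NormedSpace ℝ H]

/-- The derivatives of `f` of order at most `n` satisfy the symbol estimates of order `m`. -/
def IsSymbolUpTo (n : ℕ) (m : ℝ) (f : E → F) : Prop :=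
  ∀ k ≤ n, ∃ C, ∀ ξ, ‖iteratedFDeriv ℝ k f ξ‖ ≤ C * (1 + ‖ξ‖ ^ 2) ^ ((m - k) / 2)

theorem ContDiff.continuousLinearMap_apply₂ (B : F →L[ℝ] G →L[ℝ] H) {n : WithTop ℕ∞} {f : E → F}
    {g : E → G} (hf : ContDiff ℝ n f) (hg : ContDiff ℝ n g) :
    ContDiff ℝ n fun ξ ↦ B (f ξ) (g ξ) :=
  (B.contDiff.comp hf).clm_apply hg

theorem IsSymbolUpTo.bilinear (B : F →L[ℝ] G →L[ℝ] H) {n : ℕ} {m₁ m₂ : ℝ} {f : E → F} {g : E → G}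
    (hf : ContDiff ℝ (⊤ : ℕ∞) f) (hg : ContDiff ℝ (⊤ : ℕ∞) g)
    (sf : IsSymbolUpTo n m₁ f) (sg : IsSymbolUpTo n m₂ g) :
    IsSymbolUpTo n (m₁ + m₂) fun ξ ↦ B (f ξ) (g ξ) := by
  intro k hk
  choose! C₁ hC₁ using sf
  choose! C₂ hC₂ using sg
  refine ⟨‖B‖ * ∑ i ∈ Finset.range (k + 1), (k.choose i : ℝ) * C₁ i * C₂ (k - i), fun ξ ↦ ?_⟩
  refine (B.norm_iteratedFDeriv_le_of_bilinear hf hg ξ (n := k) (mod_cast le_top)).trans ?_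
  rw [mul_assoc, Finset.sum_mul]
  refine mul_le_mul_of_nonneg_left (Finset.sum_le_sum fun i hi ↦ ?_) (norm_nonneg B)
  have hik : i ≤ k := by simpa [Nat.lt_succ_iff] using hi
  have hpos : (0 : ℝ) < 1 + ‖ξ‖ ^ 2 := by positivity
  have h₁ := hC₁ i (hik.trans hk) ξ
  have h₂ := hC₂ (k - i) ((Nat.sub_le k i).trans hk) ξ
  have hexp : (m₁ + m₂ - k) / 2 = (m₁ - i) / 2 + (m₂ - (k - i : ℕ)) / 2 := by
    push_cast [Nat.cast_sub hik]; ring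
  rw [hexp, Real.rpow_add hpos]
  calc (k.choose i : ℝ) * ‖iteratedFDeriv ℝ i f ξ‖ * ‖iteratedFDeriv ℝ (k - i) g ξ‖
      = (k.choose i : ℝ) * (‖iteratedFDeriv ℝ i f ξ‖ * ‖iteratedFDeriv ℝ (k - i) g ξ‖) := by ring
    _ ≤ (k.choose i : ℝ) * ((C₁ i * (1 + ‖ξ‖ ^ 2) ^ ((m₁ - i) / 2)) *
          (C₂ (k - i) * (1 + ‖ξ‖ ^ 2) ^ ((m₂ - (k - i : ℕ)) / 2))) := by
        gcongr
        exact (norm_nonneg _).trans h₁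
    _ = _ := by ring

theorem IsSymbolUpTo.clm_comp (L : F →L[ℝ] G) {n : ℕ} {m : ℝ} {f : E → F}
    (hf : ContDiff ℝ (⊤ : ℕ∞) f) (sf : IsSymbolUpTo n m f) :
    IsSymbolUpTo n m fun ξ ↦ L (f ξ) := by
  intro k hk
  obtain ⟨C, hC⟩ := sf k hk
  refine ⟨‖L‖ * C, fun ξ ↦ ?_⟩
  refine (L.norm_iteratedFDeriv_comp_left (hf.contDiffAt (x := ξ)) (n := k)
    (mod_cast le_top)).trans ?_
  rw [mul_assoc]
  gcongr
  exact hC ξ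

theorem isSymbolUpTo_zero {m : ℝ} {f : E → F} :
    IsSymbolUpTo 0 m f ↔ ∃ C, ∀ ξ, ‖f ξ‖ ≤ C * (1 + ‖ξ‖ ^ 2) ^ (m / 2) := by
  simp [IsSymbolUpTo]

theorem isSymbolUpTo_succ {n : ℕ} {m : ℝ} {f : E → F} :
    IsSymbolUpTo (n + 1) m f ↔ IsSymbolUpTo 0 m f ∧ IsSymbolUpTo n (m - 1) (fderiv ℝ f) := by
  have hexp (k : ℕ) : (m - 1 - k) / 2 = (m - (k + 1 : ℕ)) / 2 := by push_cast; ring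
  constructor
  · refine fun h ↦ ⟨fun k hk ↦ h k (by omega), fun k hk ↦ ?_⟩
    simpa only [norm_iteratedFDeriv_fderiv, hexp] using h (k + 1) (by omega)
  · rintro ⟨h₀, h⟩ (_ | k) hk
    · exact h₀ 0 le_rfl
    · simpa only [norm_iteratedFDeriv_fderiv, hexp] using h k (by omega)

theorem contDiff_ringInverse_comp {R : Type*} [NormedRing R] [NormedAlgebra ℝ R] [CompleteSpace R]
    {g : E → R} (hg : ContDiff ℝ (⊤ : ℕ∞) g) (hu : ∀ ξ, IsUnit (g ξ)) :
    ContDiff ℝ (⊤ : ℕ∞) fun ξ ↦ Ring.inverse (g ξ) :=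
  contDiff_iff_contDiffAt.2 fun ξ ↦ by
    obtain ⟨u, hu⟩ := hu ξ
    have h := contDiffAt_ringInverse (n := (⊤ : ℕ∞)) ℝ u
    rw [hu] at h
    exact h.comp ξ hg.contDiffAt

theorem IsSymbolUpTo.fderiv_ringInverse {R : Type*} [NormedRing R] [NormedAlgebra ℝ R]
    [CompleteSpace R] {n : ℕ} {m₁ m₂ : ℝ} {g : E → R} (hg : ContDiff ℝ (⊤ : ℕ∞) g)
    (hu : ∀ ξ, IsUnit (g ξ)) (sT : IsSymbolUpTo n m₁ fun ξ ↦ Ring.inverse (g ξ))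
    (sg : IsSymbolUpTo n m₂ (fderiv ℝ g)) :
    IsSymbolUpTo n (m₁ + (m₁ + m₂)) (fderiv ℝ fun ξ ↦ Ring.inverse (g ξ)) := by
  have hT := contDiff_ringInverse_comp hg hu
  have hDg : ContDiff ℝ (⊤ : ℕ∞) (fderiv ℝ g) := hg.fderiv_right (by simp)
  let P := (ContinuousLinearMap.compL ℝ E R R).comp (ContinuousLinearMap.mul ℝ R).flip
  let Q := (ContinuousLinearMap.compL ℝ E R R).comp (-ContinuousLinearMap.mul ℝ R)
  have hDT : (fderiv ℝ fun ξ ↦ Ring.inverse (g ξ)) =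
      fun ξ ↦ Q (Ring.inverse (g ξ)) (P (Ring.inverse (g ξ)) (fderiv ℝ g ξ)) := by
    funext ξ
    obtain ⟨u, hu⟩ := hu ξ
    have h := hasFDerivAt_ringInverse (𝕜 := ℝ) u
    rw [← Ring.inverse_unit, hu] at h
    have h' := h.comp ξ (hg.differentiable (by simp) ξ).hasFDerivAt
    refine h'.fderiv.trans ?_
    ext v
    simp [Q, P, ContinuousLinearMap.mulLeftRight_apply, mul_assoc]
  have hP : ContDiff ℝ (⊤ : ℕ∞) fun ξ ↦ P (Ring.inverse (g ξ)) (fderiv ℝ g ξ) :=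
    hT.continuousLinearMap_apply₂ (H := E →L[ℝ] R) P hDg
  rw [hDT]
  exact sT.bilinear Q hT hP (sT.bilinear P hT hDg sg)

end Symbol

section Sylvester

variable {A : Type*} [NormedRing A] [NormedAlgebra ℝ A]

variable (A) in
/-- The operator sending `b` to the Sylvester map `x ↦ b * x + x * b`. -/
noncomputable def sylvester : A →L[ℝ] A →L[ℝ] A :=
  ContinuousLinearMap.mul ℝ A + (ContinuousLinearMap.mul ℝ A).flip

theorem ContinuousLinearMap.isUnit_of_norm_le [FiniteDimensional ℝ A] {f : A →L[ℝ] A} {K : ℝ}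
    (hf : ∀ x, ‖x‖ ≤ K * ‖f x‖) : IsUnit f := by
  have hinj : Function.Injective (f : A →ₗ[ℝ] A) := by
    rw [← LinearMap.ker_eq_bot, LinearMap.ker_eq_bot']
    intro x hx
    have := hf x
    rw [show f x = 0 from hx] at this
    simpa using this
  let e := (LinearEquiv.ofInjectiveEndo _ hinj).toContinuousLinearEquiv
  exact ⟨e.toUnit, by ext x; rfl⟩

theorem ContinuousLinearMap.norm_ringInverse_le [FiniteDimensional ℝ A] {f : A →L[ℝ] A} {K : ℝ}
    (hK : 0 ≤ K) (hf : ∀ x, ‖x‖ ≤ K * ‖f x‖) : ‖Ring.inverse f‖ ≤ K := by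
  refine ContinuousLinearMap.opNorm_le_bound _ hK fun x ↦ ?_
  have h : f (Ring.inverse f x) = x :=
    DFunLike.congr_fun (Ring.mul_inverse_cancel f (isUnit_of_norm_le hf)) x
  simpa [h] using hf (Ring.inverse f x)

theorem hasFDerivAt_mul_self (b : A) : HasFDerivAt (fun x : A ↦ x * x) (sylvester A b) b := by
  convert! (hasFDerivAt_id b).mul' (hasFDerivAt_id (𝕜 := ℝ) b) using 1

variable {E : Type*} [NormedAddCommGroup E] [NormedSpace ℝ E]

theorem contDiff_of_mul_self [FiniteDimensional ℝ A] {a b : E → A}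
    (ha : ContDiff ℝ (⊤ : ℕ∞) a) (hb : Continuous b) (hab : ∀ ξ, b ξ * b ξ = a ξ)
    (hu : ∀ ξ, IsUnit (sylvester A (b ξ))) : ContDiff ℝ (⊤ : ℕ∞) b := by
  have : CompleteSpace A := FiniteDimensional.complete ℝ A
  refine contDiff_iff_contDiffAt.2 fun ξ ↦ ?_
  obtain ⟨u, hu⟩ := hu ξ
  have hd : HasFDerivAt (fun x : A ↦ x * x)
      ((ContinuousLinearEquiv.unitsEquiv ℝ A u : A ≃L[ℝ] A) : A →L[ℝ] A) (b ξ) := by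
    have h := hasFDerivAt_mul_self (b ξ)
    rw [← hu] at h
    exact h
  have hsq : ContDiffAt ℝ (⊤ : ℕ∞) (fun x : A ↦ x * x) (b ξ) := contDiffAt_id.mul contDiffAt_id
  have hinv := hsq.to_localInverse hd (by simp)
  simp only [hab] at hinv
  refine (hinv.comp ξ ha.contDiffAt).congr_of_eventuallyEq ?_
  have hev := (hsq.hasStrictFDerivAt' hd (by simp)).eventually_left_inverse
  filter_upwards [hb.continuousAt.eventually hev] with η hη
  rw [Function.comp_apply, ← hab η]
  exact hη.symm

theorem isSymbolUpTo_of_mul_self [FiniteDimensional ℝ A] {a b : E → A} {r : ℝ}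
    (ha : ContDiff ℝ (⊤ : ℕ∞) a) (hb : ContDiff ℝ (⊤ : ℕ∞) b) (hab : ∀ ξ, b ξ * b ξ = a ξ)
    (sa : ∀ n, IsSymbolUpTo n r a) (sb : IsSymbolUpTo 0 (r / 2) b) {C : ℝ} (hC : 0 ≤ C)
    (hell : ∀ ξ x, ‖x‖ ≤ C * (1 + ‖ξ‖ ^ 2) ^ (-r / 4) * ‖sylvester A (b ξ) x‖) (n : ℕ) :
    IsSymbolUpTo n (r / 2) b := by
  have : CompleteSpace A := FiniteDimensional.complete ℝ A
  have hu (ξ) : IsUnit (sylvester A (b ξ)) := ContinuousLinearMap.isUnit_of_norm_le (hell ξ)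
  let T : E → A →L[ℝ] A := fun ξ ↦ Ring.inverse (sylvester A (b ξ))
  have hLb : ContDiff ℝ (⊤ : ℕ∞) fun ξ ↦ sylvester A (b ξ) := (sylvester A).contDiff.comp hb
  have hT : ContDiff ℝ (⊤ : ℕ∞) T := contDiff_ringInverse_comp hLb hu
  have sT : IsSymbolUpTo 0 (-r / 2) T := isSymbolUpTo_zero.2 ⟨C, fun ξ ↦ by
    rw [show -r / 2 / 2 = -r / 4 by ring]
    exact ContinuousLinearMap.norm_ringInverse_le (by positivity) (hell ξ)⟩
  have hdb (ξ) : HasFDerivAt b (fderiv ℝ b ξ) ξ :=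
    (hb.differentiable (by simp) ξ).hasFDerivAt
  have hDb : fderiv ℝ b = fun ξ ↦ ContinuousLinearMap.compL ℝ E A A (T ξ) (fderiv ℝ a ξ) := by
    funext ξ
    have h := (hasFDerivAt_mul_self (b ξ)).comp ξ (hdb ξ)
    rw [show (fun x : A ↦ x * x) ∘ b = a from funext hab] at h
    rw [h.fderiv]
    ext v
    exact (DFunLike.congr_fun (Ring.inverse_mul_cancel _ (hu ξ)) (fderiv ℝ b ξ v)).symm
  have hfa : ContDiff ℝ (⊤ : ℕ∞) (fderiv ℝ a) := ha.fderiv_right (by simp)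
  suffices IsSymbolUpTo n (r / 2) b ∧ IsSymbolUpTo n (-r / 2) T from this.1
  induction n with
  | zero => exact ⟨sb, sT⟩
  | succ n ih =>
    obtain ⟨ihb, ihT⟩ := ih
    have sDb : IsSymbolUpTo n (r / 2 - 1) (fderiv ℝ b) := by
      rw [hDb, show r / 2 - 1 = -r / 2 + (r - 1) by ring]
      exact ihT.bilinear _ hT hfa (isSymbolUpTo_succ.1 (sa (n + 1))).2
    have sb' := isSymbolUpTo_succ.2 ⟨sb, sDb⟩
    refine ⟨sb', isSymbolUpTo_succ.2 ⟨sT, ?_⟩⟩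
    rw [show -r / 2 - 1 = -r / 2 + (-r / 2 + (r / 2 - 1)) by ring]
    exact ihT.fderiv_ringInverse hLb hu (isSymbolUpTo_succ.1 (sb'.clm_comp (sylvester A) hb)).2

end Sylvester

namespace Matrix

variable {m n : Type*} [Fintype m] [Fintype n]

open scoped MatrixOrder in
theorem PosSemidef.exists_eq_conjTranspose_mul_self {A : Matrix n n ℂ} (hA : A.PosSemidef) :
    ∃ B : Matrix n n ℂ, A = Bᴴ * B := by
  classical
  exact CStarAlgebra.nonneg_iff_eq_star_mul_self.mp hA.nonneg

theorem frobenius_norm_sq (A : Matrix m n ℂ) : ‖A‖ ^ 2 = ∑ i, ∑ j, ‖A i j‖ ^ 2 := by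
  rw [frobenius_norm_def, ← Real.rpow_mul_natCast (by positivity)]
  simp

theorem norm_entry_le_frobenius_norm (A : Matrix m n ℂ) (i : m) (j : n) : ‖A i j‖ ≤ ‖A‖ := by
  rw [← abs_of_nonneg (norm_nonneg A), ← abs_of_nonneg (norm_nonneg (A i j)), ← sq_le_sq,
    frobenius_norm_sq]
  exact (Finset.single_le_sum (f := fun j ↦ ‖A i j‖ ^ 2) (fun _ _ ↦ by positivity)
    (Finset.mem_univ j)).trans
    (Finset.single_le_sum (f := fun i ↦ ∑ j, ‖A i j‖ ^ 2) (fun _ _ ↦ by positivity)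
      (Finset.mem_univ i))

theorem norm_trace_le_frobenius_norm (A : Matrix n n ℂ) : ‖A.trace‖ ≤ Fintype.card n * ‖A‖ := by
  refine (norm_sum_le _ _).trans ?_
  refine (Finset.sum_le_card_nsmul _ _ _ fun i _ ↦ A.norm_entry_le_frobenius_norm i i).trans ?_
  simp

theorem frobenius_norm_sq_eq_trace (A : Matrix m n ℂ) : ‖A‖ ^ 2 = (Aᴴ * A).trace.re := by
  rw [frobenius_norm_sq, Finset.sum_comm]
  simp [trace, mul_apply, Complex.normSq_apply, ← Complex.normSq_eq_norm_sq]

theorem frobenius_norm_sq_le_card_mul (A : Matrix m n ℂ) :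
    ‖A‖ ^ 2 ≤ Fintype.card n * ‖Aᴴ * A‖ := by
  rw [frobenius_norm_sq_eq_trace]
  exact (Complex.re_le_norm _).trans (norm_trace_le_frobenius_norm _)

/-- A Sylvester equation `b * x + x * c = y` with `b` positive semidefinite and `c` positive
definite controls its solution. -/
theorem frobenius_norm_le_of_sylvester [DecidableEq n] {b c : Matrix n n ℂ} (hb : b.PosSemidef)
    (hc : c.PosDef) (x : Matrix n n ℂ) :
    ‖x‖ ≤ (Fintype.card n : ℝ) ^ 2 * ‖c⁻¹‖ * ‖b * x + x * c‖ := by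
  obtain ⟨s, rfl⟩ := hc.posSemidef.exists_eq_conjTranspose_mul_self
  set N : ℝ := (Fintype.card n : ℝ)
  set y := b * x + x * (sᴴ * s) with hy
  have hs : IsUnit sᴴ := by
    have := hc.isUnit
    rw [isUnit_iff_isUnit_det, det_mul] at this
    exact (isUnit_iff_isUnit_det _).2 (isUnit_of_mul_isUnit_left this)
  have hx : x * sᴴ * (sᴴ)⁻¹ = x := by
    rw [mul_assoc, mul_nonsing_inv _ ((isUnit_iff_isUnit_det _).1 hs), mul_one]
  have hinv : ‖(sᴴ)⁻¹‖ ^ 2 ≤ N * ‖(sᴴ * s)⁻¹‖ := by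
    have h := frobenius_norm_sq_le_card_mul (sᴴ)⁻¹
    rwa [conjTranspose_nonsing_inv, conjTranspose_conjTranspose, ← mul_inv_rev] at h
  have htr : ‖x * sᴴ‖ ^ 2 ≤ N * (‖x‖ * ‖y‖) := by
    have h₁ : 0 ≤ (xᴴ * b * x).trace.re :=
      (Complex.nonneg_iff.1 (hb.conjTranspose_mul_mul_same x).trace_nonneg).1
    have h₂ : ‖x * sᴴ‖ ^ 2 = (xᴴ * (x * (sᴴ * s))).trace.re := by
      rw [frobenius_norm_sq_eq_trace, conjTranspose_mul, conjTranspose_conjTranspose,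
        mul_assoc, trace_mul_comm]
      simp only [mul_assoc]
    have h₃ : (xᴴ * y).trace.re ≤ N * (‖x‖ * ‖y‖) := by
      refine (Complex.re_le_norm _).trans ((norm_trace_le_frobenius_norm _).trans ?_)
      gcongr
      exact (frobenius_norm_mul _ _).trans_eq (by rw [frobenius_norm_conjTranspose])
    rw [hy, mul_add, trace_add, Complex.add_re, ← mul_assoc] at h₃
    linarith
  have hsq : ‖x‖ * ‖x‖ ≤ (N ^ 2 * ‖(sᴴ * s)⁻¹‖ * ‖y‖) * ‖x‖ := by
    calc ‖x‖ * ‖x‖ = ‖x * sᴴ * (sᴴ)⁻¹‖ ^ 2 := by rw [hx, sq]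
      _ ≤ (‖x * sᴴ‖ * ‖(sᴴ)⁻¹‖) ^ 2 := by gcongr; exact frobenius_norm_mul _ _
      _ = ‖x * sᴴ‖ ^ 2 * ‖(sᴴ)⁻¹‖ ^ 2 := mul_pow _ _ _
      _ ≤ (N * (‖x‖ * ‖y‖)) * (N * ‖(sᴴ * s)⁻¹‖) := by gcongr
      _ = _ := by ring
  rcases (norm_nonneg x).eq_or_lt with h | h
  · rw [← h]; positivity
  · exact le_of_mul_le_mul_right hsq h

theorem continuous_of_mul_self [DecidableEq n] {X : Type*} [TopologicalSpace X]
    {a b : X → Matrix n n ℂ} (ha : Continuous a) (hb : ∀ ξ, (b ξ).PosDef)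
    (hab : ∀ ξ, b ξ * b ξ = a ξ) : Continuous b := by
  refine continuous_iff_continuousAt.2 fun ξ ↦ ?_
  have hlim : Filter.Tendsto
      (fun η ↦ (Fintype.card n : ℝ) ^ 2 * ‖(b ξ)⁻¹‖ * ‖a η - a ξ‖) (nhds ξ) (nhds 0) := by
    have h : Filter.Tendsto (fun η ↦ a η - a ξ) (nhds ξ) (nhds (a ξ - a ξ)) :=
      (ha.tendsto ξ).sub_const (a ξ)
    simpa using h.norm.const_mul ((Fintype.card n : ℝ) ^ 2 * ‖(b ξ)⁻¹‖)
  refine tendsto_iff_norm_sub_tendsto_zero.2 (squeeze_zero (fun _ ↦ norm_nonneg _) (fun η ↦ ?_) hlim)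
  convert! frobenius_norm_le_of_sylvester (hb η).posSemidef (hb ξ) (b η - b ξ) using 3
  rw [← hab, ← hab]
  noncomm_ring

end Matrix

/-- If `a` is a smooth elliptic symbol of class `S^r` (all Frobenius-norm derivative
bounds `‖∂^α a(ξ)‖ ≲ (1+|ξ|²)^{(r−|α|)/2}`, `a(ξ)` Hermitian positive definite,
`‖a(ξ)⁻¹‖ ≲ (1+|ξ|²)^{−r/2}`), then the pointwise positive square root `b` of `a`
is a smooth symbol of class `S^{r/2}`, elliptic of order `r/2`. -/
theorem sqrt_symbol_class (d : ℕ) (r : ℝ)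
    (a b : EuclideanSpace ℝ (Fin d) → Matrix (Fin d) (Fin d) ℂ)
    (ha_smooth : ContDiff ℝ (⊤ : ℕ∞) a)
    (ha_bounds : ∀ n : ℕ, ∃ C > 0, ∀ ξ,
      ‖iteratedFDeriv ℝ n a ξ‖ ≤ C * (1 + ‖ξ‖ ^ 2) ^ ((r - n) / 2))
    (ha_pos : ∀ ξ, (a ξ).PosDef)
    (ha_ell : ∃ C > 0, ∀ ξ, ‖(a ξ)⁻¹‖ ≤ C * (1 + ‖ξ‖ ^ 2) ^ (-r / 2))
    (hb : ∀ ξ, (b ξ).PosDef ∧ b ξ * b ξ = a ξ) :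
    ContDiff ℝ (⊤ : ℕ∞) b ∧
    (∀ n : ℕ, ∃ C > 0, ∀ ξ,
      ‖iteratedFDeriv ℝ n b ξ‖ ≤ C * (1 + ‖ξ‖ ^ 2) ^ ((r / 2 - n) / 2)) ∧
    ∃ C > 0, ∀ ξ, ‖(b ξ)⁻¹‖ ≤ C * (1 + ‖ξ‖ ^ 2) ^ (-r / 4) := by
  let : NormedRing (Matrix (Fin d) (Fin d) ℂ) := Matrix.frobeniusNormedRing
  let : NormedAlgebra ℝ (Matrix (Fin d) (Fin d) ℂ) := Matrix.frobeniusNormedAlgebra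
  obtain ⟨K, hK, hell⟩ := ha_ell
  have hab (ξ) : b ξ * b ξ = a ξ := (hb ξ).2
  have hsq (ξ) : (b ξ)ᴴ * b ξ = a ξ := by rw [(hb ξ).1.isHermitian.eq, hab]
  have hw (ξ : EuclideanSpace ℝ (Fin d)) : (0 : ℝ) < 1 + ‖ξ‖ ^ 2 := by positivity
  have le_of_sq {s C : ℝ} (hC : 0 < C) (ξ : EuclideanSpace ℝ (Fin d)) {x : ℝ}
      (hx : x ^ 2 ≤ d * (C * (1 + ‖ξ‖ ^ 2) ^ s)) :
      x ≤ (√(d * C) + 1) * (1 + ‖ξ‖ ^ 2) ^ (s / 2) := by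
    have hs : (1 + ‖ξ‖ ^ 2) ^ s = ((1 + ‖ξ‖ ^ 2) ^ (s / 2)) ^ 2 := by
      rw [← Real.rpow_mul_natCast (hw ξ).le]; norm_num
    have hp := Real.rpow_pos_of_pos (hw ξ) (s / 2)
    have h := Real.sq_sqrt (show 0 ≤ d * C by positivity)
    calc x ≤ √(d * C) * (1 + ‖ξ‖ ^ 2) ^ (s / 2) := by
          refine le_of_sq_le_sq ?_ (by positivity)
          rw [mul_pow, h, ← hs]
          linarith
      _ ≤ _ := by gcongr; linarith
  have hinv (ξ) : ‖(b ξ)⁻¹‖ ≤ (√(d * K) + 1) * (1 + ‖ξ‖ ^ 2) ^ (-r / 4) := by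
    rw [show -r / 4 = -r / 2 / 2 by ring]
    refine le_of_sq hK ξ ?_
    have h := frobenius_norm_sq_le_card_mul (b ξ)⁻¹
    rw [conjTranspose_nonsing_inv, (hb ξ).1.isHermitian.eq, ← Matrix.mul_inv_rev, hab,
      Fintype.card_fin] at h
    exact h.trans (by gcongr; exact hell ξ)
  have hsylv (ξ) (x : Matrix (Fin d) (Fin d) ℂ) : ‖x‖ ≤
      (d : ℝ) ^ 2 * (√(d * K) + 1) * (1 + ‖ξ‖ ^ 2) ^ (-r / 4) * ‖b ξ * x + x * b ξ‖ := by
    have h := frobenius_norm_le_of_sylvester (hb ξ).1.posSemidef (hb ξ).1 x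
    rw [Fintype.card_fin] at h
    refine h.trans ?_
    rw [mul_assoc _ _ ((1 + ‖ξ‖ ^ 2) ^ (-r / 4))]
    gcongr
    exact hinv ξ
  have hb_smooth : ContDiff ℝ (⊤ : ℕ∞) b :=
    contDiff_of_mul_self ha_smooth
      (continuous_of_mul_self ha_smooth.continuous (fun ξ ↦ (hb ξ).1) hab) hab
      fun ξ ↦ ContinuousLinearMap.isUnit_of_norm_le (hsylv ξ)
  have hb_zero : IsSymbolUpTo 0 (r / 2) b := by
    obtain ⟨C, hC, h₀⟩ := ha_bounds 0
    refine isSymbolUpTo_zero.2 ⟨_, fun ξ ↦ le_of_sq hC ξ ?_⟩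
    have h := frobenius_norm_sq_le_card_mul (b ξ)
    rw [hsq, Fintype.card_fin] at h
    have h₁ := h₀ ξ
    rw [norm_iteratedFDeriv_zero, Nat.cast_zero, sub_zero] at h₁
    exact h.trans (by gcongr)
  refine ⟨hb_smooth, fun n ↦ ?_, _, by positivity, hinv⟩
  have ha_symbol (n : ℕ) : IsSymbolUpTo n r a := fun k _ ↦
    let ⟨C, _, h⟩ := ha_bounds k
    ⟨C, h⟩
  obtain ⟨C, hC⟩ := isSymbolUpTo_of_mul_self ha_smooth hb_smooth hab ha_symbol hb_zero
    (by positivity) hsylv n n le_rfl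
  refine ⟨max C 1, by positivity, fun ξ ↦ (hC ξ).trans ?_⟩
  gcongr
  exact le_max_left _ _
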